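/- arXiv:1002.3717 — 5 statements merged into one kernel-verified Lean document; each statement's English description precedes it below -/
import Mathlib

section
/- Let X be a measurable space, μ a probability measure on X, N ≥ 1 an integer, and V an N-dimensional complex subspace of the bounded measurable functions X → ℂ such that (i) every f ∈ V with ∫_X |f|² dμ = 0 equals the zero function, and (ii) for every x ∈ X there exists f ∈ V with f(x) ≠ 0. Fix an integer k ≥ 1 and a real number a > 0, and for a bounded measurable φ : X → ℝ define T_a(φ)(x) := (1/k)·log((1/N)·sup{ |f(x)|² : f ∈ V, ∫_X |f|² e^{−aφ} dμ ≤ 1 }). Then for all bounded measurable φ, ψ : X → ℝ one has sup_{x∈X} |T_a(φ)(x) − T_a(ψ)(x)| ≤ (a/k)·sup_{x∈X} |φ(x) − ψ(x)|. In particular, for a = k the map T_a is non-expansive for the sup-distance, and for a = k−1 (with k ≥ 2) it is a contraction with factor 1 − 1/k. -/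
open MeasureTheory

/-- One step of the abstract (relative) Bergman iteration at level `k`, written
via the extremal characterization of the Bergman function:
`T_a(φ)(x) = (1/k)·log((1/N)·sup{ |f(x)|² : f ∈ V, ∫ |f|² e^{-aφ} dμ ≤ 1 })`. -/
noncomputable def bergmanStep {X : Type*} [MeasurableSpace X] (μ : Measure X)
    (V : Submodule ℂ (X → ℂ)) (N k : ℕ) (a : ℝ) (φ : X → ℝ) (x : X) : ℝ :=
  (1 / (k : ℝ)) * Real.log ((1 / (N : ℝ)) *
    sSup {r : ℝ | ∃ f ∈ V,
      (∫ y, ‖f y‖ ^ 2 * Real.exp (-(a * φ y)) ∂μ) ≤ 1 ∧ r = ‖f x‖ ^ 2})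

/-- The values `|f(x)|²` of the competitors in the extremal problem defining the Bergman
function with weight `e^{-aφ}` at the point `x`. -/
def bergmanValues {X : Type*} [MeasurableSpace X] (μ : Measure X)
    (V : Submodule ℂ (X → ℂ)) (a : ℝ) (φ : X → ℝ) (x : X) : Set ℝ :=
  {r : ℝ | ∃ f ∈ V,
    (∫ y, ‖f y‖ ^ 2 * Real.exp (-(a * φ y)) ∂μ) ≤ 1 ∧ r = ‖f x‖ ^ 2}

lemma bergmanStep_eq {X : Type*} [MeasurableSpace X] (μ : Measure X)
    (V : Submodule ℂ (X → ℂ)) (N k : ℕ) (a : ℝ) (φ : X → ℝ) (x : X) :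
    bergmanStep μ V N k a φ x =
      (1 / (k : ℝ)) * Real.log ((1 / (N : ℝ)) * sSup (bergmanValues μ V a φ x)) :=
  rfl

lemma integrable_normSq_mul_exp {X : Type*} [MeasurableSpace X] {μ : Measure X}
    [IsFiniteMeasure μ] {f : X → ℂ} {φ : X → ℝ} (a : ℝ)
    (hf : Measurable f) (hfb : ∃ C : ℝ, ∀ x, ‖f x‖ ≤ C)
    (hφ : Measurable φ) (hφb : ∃ C : ℝ, ∀ x, |φ x| ≤ C) :
    Integrable (fun y => ‖f y‖ ^ 2 * Real.exp (-(a * φ y))) μ := by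
  obtain ⟨C, hC⟩ := hfb
  obtain ⟨B, hB⟩ := hφb
  refine Integrable.of_bound (C := C ^ 2 * Real.exp (|a| * B))
    (by fun_prop : Measurable _).aestronglyMeasurable (ae_of_all _ fun y => ?_)
  rw [Real.norm_of_nonneg (by positivity)]
  have hexp : -(a * φ y) ≤ |a| * B :=
    (neg_le_abs _).trans (by rw [abs_mul]; gcongr; exact hB y)
  gcongr
  exact hC y

lemma mul_sq_mem_bergmanValues {X : Type*} [MeasurableSpace X] {μ : Measure X}
    {V : Submodule ℂ (X → ℂ)} {a : ℝ} {φ : X → ℝ} {f : X → ℂ} (hf : f ∈ V) {c : ℝ}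
    (hc : 0 ≤ c) (h : c * (∫ y, ‖f y‖ ^ 2 * Real.exp (-(a * φ y)) ∂μ) ≤ 1) (x : X) :
    c * ‖f x‖ ^ 2 ∈ bergmanValues μ V a φ x := by
  have key : ∀ y, ‖(((Real.sqrt c : ℝ) : ℂ) • f) y‖ ^ 2 = c * ‖f y‖ ^ 2 := fun y => by
    rw [Pi.smul_apply, norm_smul, mul_pow, Complex.norm_real, Real.norm_eq_abs, sq_abs,
      Real.sq_sqrt hc]
  refine ⟨((Real.sqrt c : ℝ) : ℂ) • f, V.smul_mem _ hf, ?_, (key x).symm⟩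
  simp only [key, mul_assoc, integral_const_mul]
  exact h

lemma exists_pos_mem_bergmanValues {X : Type*} [MeasurableSpace X] (μ : Measure X)
    {V : Submodule ℂ (X → ℂ)} (a : ℝ) (φ : X → ℝ) {x : X} (hx : ∃ f ∈ V, f x ≠ 0) :
    ∃ r ∈ bergmanValues μ V a φ x, 0 < r := by
  obtain ⟨f, hf, hfx⟩ := hx
  set I := ∫ y, ‖f y‖ ^ 2 * Real.exp (-(a * φ y)) ∂μ with hI
  have hI0 : 0 ≤ I := integral_nonneg fun y => by positivity
  have hfx' : 0 < ‖f x‖ := norm_pos_iff.mpr hfx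
  refine ⟨(I + 1)⁻¹ * ‖f x‖ ^ 2, mul_sq_mem_bergmanValues hf (by positivity) ?_ x,
    by positivity⟩
  rw [← hI, inv_mul_le_iff₀ (by positivity)]
  linarith

/-- Monotonicity and scaling: a weight bounded by `φ + D` has competitors bounded, up to
the factor `e^{aD}`, by those of `φ`. -/
lemma exp_mul_mem_bergmanValues {X : Type*} [MeasurableSpace X] {μ : Measure X}
    [IsFiniteMeasure μ] {V : Submodule ℂ (X → ℂ)} {a D : ℝ} (ha : 0 ≤ a)
    (hVmeas : ∀ f ∈ V, Measurable f) (hVbdd : ∀ f ∈ V, ∃ C : ℝ, ∀ x, ‖f x‖ ≤ C)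
    {φ ψ : X → ℝ} (hφm : Measurable φ) (hψm : Measurable ψ)
    (hφb : ∃ C : ℝ, ∀ x, |φ x| ≤ C) (hψb : ∃ C : ℝ, ∀ x, |ψ x| ≤ C)
    (hD : ∀ y, φ y ≤ ψ y + D) {x : X} {r : ℝ} (hr : r ∈ bergmanValues μ V a φ x) :
    Real.exp (-(a * D)) * r ∈ bergmanValues μ V a ψ x := by
  obtain ⟨f, hf, hint, rfl⟩ := hr
  refine mul_sq_mem_bergmanValues hf (Real.exp_nonneg _) (le_trans ?_ hint) x
  rw [← integral_const_mul]
  refine integral_mono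
    ((integrable_normSq_mul_exp a (hVmeas f hf) (hVbdd f hf) hψm hψb).const_mul _)
    (integrable_normSq_mul_exp a (hVmeas f hf) (hVbdd f hf) hφm hφb) fun y => ?_
  have hexp : Real.exp (-(a * D)) * Real.exp (-(a * ψ y)) ≤ Real.exp (-(a * φ y)) := by
    rw [← Real.exp_add, Real.exp_le_exp]
    nlinarith [mul_le_mul_of_nonneg_left (hD y) ha]
  calc Real.exp (-(a * D)) * (‖f y‖ ^ 2 * Real.exp (-(a * ψ y)))
      = ‖f y‖ ^ 2 * (Real.exp (-(a * D)) * Real.exp (-(a * ψ y))) := by ring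
    _ ≤ ‖f y‖ ^ 2 * Real.exp (-(a * φ y)) := by gcongr

lemma bddAbove_of_exp_mul_mem {S T : Set ℝ} {c : ℝ}
    (h : ∀ r ∈ S, Real.exp (-c) * r ∈ T) (hT : BddAbove T) : BddAbove S := by
  obtain ⟨B, hB⟩ := hT
  refine ⟨Real.exp c * B, fun r hr => ?_⟩
  have := hB (h r hr)
  rwa [Real.exp_neg, inv_mul_le_iff₀ (Real.exp_pos _)] at this

lemma log_mul_sSup_le {S T : Set ℝ} {b c : ℝ} (hb : 0 < b)
    (hS : ∃ r ∈ S, 0 < r) (hT : ∃ r ∈ T, 0 < r) (hSb : BddAbove S) (hTb : BddAbove T)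
    (h : ∀ r ∈ S, Real.exp (-c) * r ∈ T) :
    Real.log (b * sSup S) ≤ Real.log (b * sSup T) + c := by
  obtain ⟨r, hr, hr0⟩ := hS
  obtain ⟨t, ht, ht0⟩ := hT
  have hSpos : 0 < sSup S := hr0.trans_le (le_csSup hSb hr)
  have hTpos : 0 < sSup T := ht0.trans_le (le_csSup hTb ht)
  have hle : sSup S ≤ Real.exp c * sSup T := csSup_le ⟨r, hr⟩ fun s hs => by
    have := le_csSup hTb (h s hs)
    rwa [Real.exp_neg, inv_mul_le_iff₀ (Real.exp_pos _)] at this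
  have := Real.log_le_log hSpos hle
  rw [Real.log_mul (Real.exp_pos _).ne' hTpos.ne', Real.log_exp] at this
  rw [Real.log_mul hb.ne' hSpos.ne', Real.log_mul hb.ne' hTpos.ne']
  linarith

/-- If the sets are unbounded, both suprema take the default value `0`. -/
lemma abs_log_mul_sSup_sub_le {S T : Set ℝ} {b c : ℝ} (hb : 0 < b) (hc : 0 ≤ c)
    (hS : ∃ r ∈ S, 0 < r) (hT : ∃ r ∈ T, 0 < r)
    (hST : ∀ r ∈ S, Real.exp (-c) * r ∈ T) (hTS : ∀ r ∈ T, Real.exp (-c) * r ∈ S) :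
    |Real.log (b * sSup S) - Real.log (b * sSup T)| ≤ c := by
  by_cases hSb : BddAbove S
  · have hTb := bddAbove_of_exp_mul_mem hTS hSb
    rw [abs_sub_le_iff]
    constructor
    · linarith [log_mul_sSup_le hb hS hT hSb hTb hST]
    · linarith [log_mul_sSup_le hb hT hS hTb hSb hTS]
  · have hTb : ¬ BddAbove T := fun hTb => hSb (bddAbove_of_exp_mul_mem hST hTb)
    simpa [Real.sSup_of_not_bddAbove hSb, Real.sSup_of_not_bddAbove hTb] using hc

/-- The abstract Bergman iteration step satisfies
`sup_x |T_a(φ)(x) − T_a(ψ)(x)| ≤ (a/k) · sup_x |φ(x) − ψ(x)|`; in particular it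
is non-expansive for the sup-distance when `a = k` and a contraction with
factor `1 − 1/k` when `a = k − 1`. -/
theorem bergmanStep_dist_le
    {X : Type*} [MeasurableSpace X] (μ : Measure X) [IsProbabilityMeasure μ]
    (N k : ℕ) (hN : 1 ≤ N) (hk : 1 ≤ k) (a : ℝ) (ha : 0 < a)
    (V : Submodule ℂ (X → ℂ))
    (hVmeas : ∀ f ∈ V, Measurable f)
    (hVbdd : ∀ f ∈ V, ∃ C : ℝ, ∀ x, ‖f x‖ ≤ C)
    (hVdim : Module.finrank ℂ V = N)
    (hVnondeg : ∀ f ∈ V, (∫ x, ‖f x‖ ^ 2 ∂μ) = 0 → f = 0)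
    (hVpt : ∀ x : X, ∃ f ∈ V, f x ≠ 0)
    (φ ψ : X → ℝ) (hφm : Measurable φ) (hψm : Measurable ψ)
    (hφb : ∃ C : ℝ, ∀ x, |φ x| ≤ C) (hψb : ∃ C : ℝ, ∀ x, |ψ x| ≤ C) :
    (⨆ x : X, |bergmanStep μ V N k a φ x - bergmanStep μ V N k a ψ x|) ≤
      (a / (k : ℝ)) * ⨆ x : X, |φ x - ψ x| := by
  have : Nonempty X := μ.nonempty_of_neZero
  have hk0 : (0 : ℝ) < k := by exact_mod_cast hk
  have hN0 : (0 : ℝ) < 1 / (N : ℝ) := one_div_pos.mpr (by exact_mod_cast hN)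
  have hbdd : BddAbove (Set.range fun x => |φ x - ψ x|) := by
    obtain ⟨B, hB⟩ := hφb
    obtain ⟨C, hC⟩ := hψb
    refine ⟨B + C, ?_⟩
    rintro _ ⟨x, rfl⟩
    exact (abs_sub _ _).trans (add_le_add (hB x) (hC x))
  set D := ⨆ x : X, |φ x - ψ x|
  have hD : ∀ y, |φ y - ψ y| ≤ D := le_ciSup hbdd
  have hD0 : 0 ≤ D := Real.iSup_nonneg fun x => abs_nonneg _
  refine ciSup_le fun x => ?_
  have hlog := abs_log_mul_sSup_sub_le hN0 (mul_nonneg ha.le hD0)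
    (exists_pos_mem_bergmanValues μ a φ (hVpt x)) (exists_pos_mem_bergmanValues μ a ψ (hVpt x))
    (fun r => exp_mul_mem_bergmanValues ha.le hVmeas hVbdd hφm hψm hφb hψb
      fun y => by linarith [(abs_le.mp (hD y)).2])
    (fun r => exp_mul_mem_bergmanValues ha.le hVmeas hVbdd hψm hφm hψb hφb
      fun y => by linarith [(abs_le.mp (hD y)).1])
  rw [bergmanStep_eq, bergmanStep_eq, ← mul_sub, abs_mul, abs_of_pos (one_div_pos.mpr hk0)]
  calc _ ≤ 1 / (k : ℝ) * (a * D) := by gcongr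
    _ = a / (k : ℝ) * D := by ring
end

section
/- Let X be a measurable space, μ a probability measure on X, N ≥ 1 and k ≥ 1 integers, and V an N-dimensional complex subspace of the bounded measurable functions X → ℂ such that (i) every f ∈ V with ∫_X |f|² dμ = 0 equals the zero function, and (ii) for every x ∈ X there exists f ∈ V with f(x) ≠ 0. Given a bounded measurable φ : X → ℝ, let (f_1, …, f_N) be an orthonormal basis of V for the inner product ⟨f, g⟩_φ := ∫_X f·conj(g)·e^{−kφ} dμ, set B := (1/N)·Σ_{i=1}^N |f_i|² (a strictly positive function) and define the Bergman iteration step T(φ) := (1/k)·log B, so that e^{−k·T(φ)} = 1/B. Then the N×N Hermitian matrix G with entries G_{ij} := ∫_X f_i·conj(f_j)·(1/B) dμ (the Gram matrix of (f_1,…,f_N) for the inner product ⟨·,·⟩_{T(φ)}) satisfies trace G = N and det G ≤ 1. -/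
open MeasureTheory

namespace Matrix

open scoped ComplexOrder

theorem PosSemidef.det_re_le_one_of_trace_eq_card {n : Type*} [Fintype n] [DecidableEq n]
    {A : Matrix n n ℂ} (hA : A.PosSemidef) (htr : A.trace = Fintype.card n) :
    A.det.im = 0 ∧ A.det.re ≤ 1 := by
  have hH := hA.isHermitian
  have hdet : A.det = ((∏ i, hH.eigenvalues i : ℝ) : ℂ) := by
    rw [hH.det_eq_prod_eigenvalues]; push_cast; rfl
  have hsum : ∑ i, hH.eigenvalues i = Fintype.card n := by
    have h := hH.trace_eq_sum_eigenvalues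
    rw [htr] at h
    apply Complex.ofReal_injective
    push_cast
    exact h.symm
  rw [hdet]
  refine ⟨Complex.ofReal_im _, ?_⟩
  rw [Complex.ofReal_re]
  calc ∏ i, hH.eigenvalues i ≤ ∏ i, Real.exp (hH.eigenvalues i - 1) :=
        Finset.prod_le_prod (fun i _ => hA.eigenvalues_nonneg i)
          fun i _ => by linarith [Real.add_one_le_exp (hH.eigenvalues i - 1)]
    _ = 1 := by
        rw [← Real.exp_sum, Finset.sum_sub_distrib, hsum]
        simp

/-- A weighted Gram matrix of complex functions is positive semidefinite. -/
theorem posSemidef_of_integral_mul_conj {X n : Type*} [MeasurableSpace X] [Fintype n]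
    {μ : MeasureTheory.Measure X} {f : n → X → ℂ} {w : X → ℝ} (hw : ∀ x, 0 ≤ w x)
    (hint : ∀ i j, MeasureTheory.Integrable
      (fun x => f i x * (starRingEnd ℂ) (f j x) * ((w x : ℝ) : ℂ)) μ) :
    (Matrix.of fun i j => ∫ x, f i x * (starRingEnd ℂ) (f j x) * ((w x : ℝ) : ℂ) ∂μ).PosSemidef := by
  refine PosSemidef.of_dotProduct_mulVec_nonneg ?_ fun v => ?_
  · ext i j
    simp only [conjTranspose_apply, of_apply]
    rw [← starRingEnd_apply, ← integral_conj]
    congr 1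
    funext x
    simp only [map_mul, Complex.conj_conj, Complex.conj_ofReal]
    ring
  · have key : star v ⬝ᵥ (Matrix.of fun i j =>
        ∫ x, f i x * (starRingEnd ℂ) (f j x) * ((w x : ℝ) : ℂ) ∂μ) *ᵥ v
        = ∫ x, ((‖∑ i, (starRingEnd ℂ) (v i) * f i x‖ ^ 2 * w x : ℝ) : ℂ) ∂μ := by
      have h : ∀ x, ((‖∑ i, (starRingEnd ℂ) (v i) * f i x‖ ^ 2 * w x : ℝ) : ℂ)
          = ∑ i, ∑ j, (starRingEnd ℂ) (v i) * v j *
            (f i x * (starRingEnd ℂ) (f j x) * ((w x : ℝ) : ℂ)) := by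
        intro x
        push_cast
        rw [← Complex.mul_conj', map_sum, Finset.sum_mul_sum, Finset.sum_mul]
        refine Finset.sum_congr rfl fun i _ => ?_
        rw [Finset.sum_mul]
        refine Finset.sum_congr rfl fun j _ => ?_
        simp only [map_mul, Complex.conj_conj]
        ring
      simp_rw [h]
      rw [MeasureTheory.integral_finsetSum _ fun i _ =>
        MeasureTheory.integrable_finsetSum _ fun j _ => (hint i j).const_mul _]
      simp only [dotProduct, mulVec, of_apply, Finset.mul_sum]
      refine Finset.sum_congr rfl fun i _ => ?_
      rw [MeasureTheory.integral_finsetSum _ fun j _ => (hint i j).const_mul _]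
      refine Finset.sum_congr rfl fun j _ => ?_
      rw [MeasureTheory.integral_const_mul, Pi.star_apply, starRingEnd_apply]
      ring
    rw [key, integral_complex_ofReal, Complex.zero_le_real]
    exact MeasureTheory.integral_nonneg fun x => mul_nonneg (sq_nonneg _) (hw x)

end Matrix

/-- Abstract content of Donaldson's monotonicity: if `(f_1, …, f_N)` is an
orthonormal basis of `V` for the inner product `⟨f,g⟩_φ = ∫ f·conj g·e^{-kφ} dμ`,
`B = (1/N)·Σ |f_i|²` and `T(φ) = (1/k)·log B` (so `e^{-k·T(φ)} = 1/B`), then the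
Gram matrix `G` of `(f_i)` with respect to `⟨·,·⟩_{T(φ)}`, namely
`G_{ij} = ∫ f_i·conj f_j·(1/B) dμ`, satisfies `trace G = N` and `det G ≤ 1`. -/
theorem gram_matrix_trace_eq_det_le
    {X : Type*} [MeasurableSpace X] (μ : Measure X) [IsProbabilityMeasure μ]
    (N k : ℕ) (hN : 1 ≤ N) (hk : 1 ≤ k)
    (V : Submodule ℂ (X → ℂ))
    (hVmeas : ∀ f ∈ V, Measurable f)
    (hVbdd : ∀ f ∈ V, ∃ C : ℝ, ∀ x, ‖f x‖ ≤ C)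
    (hVdim : Module.finrank ℂ V = N)
    (hVnondeg : ∀ f ∈ V, (∫ x, ‖f x‖ ^ 2 ∂μ) = 0 → f = 0)
    (hVpt : ∀ x : X, ∃ f ∈ V, f x ≠ 0)
    (φ : X → ℝ) (hφm : Measurable φ) (hφb : ∃ C : ℝ, ∀ x, |φ x| ≤ C)
    (f : Fin N → X → ℂ) (hfV : ∀ i, f i ∈ V)
    (hspan : Submodule.span ℂ (Set.range f) = V)
    (hON : ∀ i j, (∫ x, f i x * (starRingEnd ℂ) (f j x) *
        ((Real.exp (-((k : ℝ) * φ x)) : ℝ) : ℂ) ∂μ) = if i = j then 1 else 0)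
    (B : X → ℝ) (hB : ∀ x, B x = (1 / (N : ℝ)) * ∑ i, ‖f i x‖ ^ 2)
    (G : Matrix (Fin N) (Fin N) ℂ)
    (hG : ∀ i j, G i j = ∫ x, f i x * (starRingEnd ℂ) (f j x) *
        ((1 / B x : ℝ) : ℂ) ∂μ) :
    Matrix.trace G = (N : ℂ) ∧ (Matrix.det G).im = 0 ∧ (Matrix.det G).re ≤ 1 := by
  have hN0 : (0 : ℝ) < N := by exact_mod_cast hN
  have hNB : ∀ x, ∑ i, ‖f i x‖ ^ 2 = N * B x := fun x => by rw [hB]; field_simp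
  have hle : ∀ i x, ‖f i x‖ ^ 2 ≤ N * B x := fun i x => by
    rw [← hNB]
    exact Finset.single_le_sum (f := fun i => ‖f i x‖ ^ 2)
      (fun _ _ => sq_nonneg _) (Finset.mem_univ i)
  have hBpos : ∀ x, 0 < B x := by
    intro x
    by_contra! hx
    obtain ⟨g, hgV, hgx⟩ := hVpt x
    have hker : V ≤ LinearMap.ker (LinearMap.proj x : (X → ℂ) →ₗ[ℂ] ℂ) := by
      rw [← hspan, Submodule.span_le]
      rintro _ ⟨i, rfl⟩
      have h2 : ‖f i x‖ ^ 2 ≤ 0 :=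
        (hle i x).trans (mul_nonpos_of_nonneg_of_nonpos hN0.le hx)
      have h3 : ‖f i x‖ = 0 := by
        simpa using le_antisymm h2 (sq_nonneg _)
      simpa using h3
    exact hgx (by simpa using hker hgV)
  have hfm : ∀ i, Measurable (f i) := fun i => hVmeas _ (hfV i)
  have hBm : Measurable B := by
    rw [funext hB]
    fun_prop
  have hint : ∀ i j, Integrable
      (fun x => f i x * (starRingEnd ℂ) (f j x) * ((1 / B x : ℝ) : ℂ)) μ := by
    intro i j
    refine Integrable.of_bound (C := N) ?_ (Filter.Eventually.of_forall fun x => ?_)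
    · have hc : Measurable fun x => (starRingEnd ℂ) (f j x) :=
        Complex.continuous_conj.measurable.comp (hfm j)
      exact (((hfm i).mul hc).mul
        (Complex.measurable_ofReal.comp (hBm.const_div 1))).aestronglyMeasurable
    · rw [norm_mul, norm_mul, RCLike.norm_conj, Complex.norm_real, Real.norm_eq_abs,
        abs_of_pos (one_div_pos.mpr (hBpos x)), mul_one_div, div_le_iff₀ (hBpos x)]
      nlinarith [hle i x, hle j x, sq_nonneg (‖f i x‖ - ‖f j x‖)]
  have htr : Matrix.trace G = (N : ℂ) := by
    simp only [Matrix.trace, Matrix.diag_apply, hG]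
    rw [← integral_finsetSum _ fun i _ => hint i i]
    have h : ∀ x, ∑ i, f i x * (starRingEnd ℂ) (f i x) * ((1 / B x : ℝ) : ℂ) = (N : ℂ) := by
      intro x
      have hB0 : (B x : ℂ) ≠ 0 := by exact_mod_cast (hBpos x).ne'
      have hc : ∑ i, ((‖f i x‖ : ℂ)) ^ 2 = N * B x := by exact_mod_cast hNB x
      rw [← Finset.sum_mul]
      simp_rw [Complex.mul_conj']
      rw [hc]
      push_cast
      field_simp
    simp_rw [h]
    simp
  open scoped ComplexOrder in
  have hpos : G.PosSemidef := by
    have hGeq : G = Matrix.of fun i j =>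
        ∫ x, f i x * (starRingEnd ℂ) (f j x) * ((1 / B x : ℝ) : ℂ) ∂μ := by
      ext i j
      exact hG i j
    rw [hGeq]
    exact Matrix.posSemidef_of_integral_mul_conj
      (fun x => (one_div_pos.mpr (hBpos x)).le) hint
  exact ⟨htr, hpos.det_re_le_one_of_trace_eq_card (by simpa using htr)⟩
end

section
/- Let X be a measurable space, μ a probability measure on X, N ≥ 1 and k ≥ 1 integers, and V an N-dimensional complex subspace of the bounded measurable functions X → ℂ such that (i) every f ∈ V with ∫_X |f|² dμ = 0 equals the zero function, and (ii) for every x ∈ X there exists f ∈ V with f(x) ≠ 0. Given a bounded measurable φ : X → ℝ, let (f_1, …, f_N) be an orthonormal basis of V for the inner product ⟨f, g⟩_φ := ∫_X f·conj(g)·e^{−kφ} dμ, set B := (1/N)·Σ_{i=1}^N |f_i|² and define the Bergman iteration step T(φ) := (1/k)·log B. Then ∫_X (T(φ) − φ) dμ ≤ 0. -/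
open MeasureTheory

/-- If every member of a family of functions vanishes at a point, so does every function in its
complex span. -/
theorem apply_eq_zero_of_mem_span_range {ι X : Type*} {f : ι → X → ℂ} {x : X}
    (hf : ∀ i, f i x = 0) {g : X → ℂ} (hg : g ∈ Submodule.span ℂ (Set.range f)) : g x = 0 := by
  have hle : Submodule.span ℂ (Set.range f) ≤
      LinearMap.ker (LinearMap.proj x : (X → ℂ) →ₗ[ℂ] ℂ) := by
    rw [Submodule.span_le]
    rintro _ ⟨i, rfl⟩
    simpa using hf i
  simpa using hle hg

/-- If `exp u` is integrable with integral at most one with respect to a probability measure, then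
`∫ u ≤ 0`. -/
theorem integral_nonpos_of_integral_exp_le_one {X : Type*} [MeasurableSpace X] {μ : Measure X}
    [IsProbabilityMeasure μ] {u : X → ℝ} (hint : Integrable (fun x => Real.exp (u x)) μ)
    (hle : ∫ x, Real.exp (u x) ∂μ ≤ 1) : ∫ x, u x ∂μ ≤ 0 := by
  by_cases hu : Integrable u μ
  · calc ∫ x, u x ∂μ ≤ ∫ x, (Real.exp (u x) - 1) ∂μ :=
          integral_mono hu (hint.sub (integrable_const 1)) fun x => by
            linarith [Real.add_one_le_exp (u x)]
      _ = ∫ x, Real.exp (u x) ∂μ - 1 := by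
          rw [integral_sub hint (integrable_const 1)]
          simp
      _ ≤ 0 := by linarith
  · exact (integral_undef hu).le

/-- Abstract content of the monotonicity of `−I_μ` along the Bergman iteration
in the Calabi–Yau setting: if `(f_1, …, f_N)` is an orthonormal basis of `V`
for the inner product `⟨f,g⟩_φ = ∫ f·conj g·e^{-kφ} dμ`, `B = (1/N)·Σ |f_i|²`
and `T(φ) = (1/k)·log B`, then `∫ (T(φ) − φ) dμ ≤ 0`. -/
theorem bergman_iteration_I_decreasing
    {X : Type*} [MeasurableSpace X] (μ : Measure X) [IsProbabilityMeasure μ]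
    (N k : ℕ) (hN : 1 ≤ N) (hk : 1 ≤ k)
    (V : Submodule ℂ (X → ℂ))
    (hVmeas : ∀ f ∈ V, Measurable f)
    (hVbdd : ∀ f ∈ V, ∃ C : ℝ, ∀ x, ‖f x‖ ≤ C)
    (hVdim : Module.finrank ℂ V = N)
    (hVnondeg : ∀ f ∈ V, (∫ x, ‖f x‖ ^ 2 ∂μ) = 0 → f = 0)
    (hVpt : ∀ x : X, ∃ f ∈ V, f x ≠ 0)
    (φ : X → ℝ) (hφm : Measurable φ) (hφb : ∃ C : ℝ, ∀ x, |φ x| ≤ C)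
    (f : Fin N → X → ℂ) (hfV : ∀ i, f i ∈ V)
    (hspan : Submodule.span ℂ (Set.range f) = V)
    (hON : ∀ i j, (∫ x, f i x * (starRingEnd ℂ) (f j x) *
        ((Real.exp (-((k : ℝ) * φ x)) : ℝ) : ℂ) ∂μ) = if i = j then 1 else 0)
    (B : X → ℝ) (hB : ∀ x, B x = (1 / (N : ℝ)) * ∑ i, ‖f i x‖ ^ 2) :
    (∫ x, ((1 / (k : ℝ)) * Real.log (B x) - φ x) ∂μ) ≤ 0 := by
  have hN0 : (0 : ℝ) < N := by exact_mod_cast hN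
  have hk0 : (0 : ℝ) < k := by exact_mod_cast hk
  have hBpos (x : X) : 0 < B x := by
    rw [hB]
    refine mul_pos (by positivity) ?_
    obtain ⟨g, hg, hgx⟩ := hVpt x
    obtain ⟨i, hi⟩ : ∃ i, f i x ≠ 0 := by
      by_contra! h
      exact hgx (apply_eq_zero_of_mem_span_range h (hspan ▸ hg))
    exact Finset.sum_pos' (fun _ _ => by positivity) ⟨i, Finset.mem_univ i, by positivity⟩
  have hnorm (i : Fin N) : ∫ x, ‖f i x‖ ^ 2 * Real.exp (-((k : ℝ) * φ x)) ∂μ = 1 := by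
    have h := hON i i
    simp only [Complex.mul_conj', if_true] at h
    exact_mod_cast h
  have hint (i : Fin N) : Integrable (fun x => ‖f i x‖ ^ 2 * Real.exp (-((k : ℝ) * φ x))) μ := by
    by_contra h
    simpa [integral_undef h] using hnorm i
  have hexp : (fun x => Real.exp (Real.log (B x) - k * φ x)) =
      fun x => (1 / (N : ℝ)) * ∑ i, ‖f i x‖ ^ 2 * Real.exp (-((k : ℝ) * φ x)) := by
    funext x
    rw [sub_eq_add_neg, Real.exp_add, Real.exp_log (hBpos x), hB, mul_assoc, Finset.sum_mul]
  have hle : ∫ x, (Real.log (B x) - k * φ x) ∂μ ≤ 0 := by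
    apply integral_nonpos_of_integral_exp_le_one
    · rw [hexp]
      exact (integrable_finsetSum _ fun i _ => hint i).const_mul _
    · rw [hexp, integral_const_mul, integral_finsetSum _ fun i _ => hint i]
      simp [hnorm, hN0.ne']
  have hscale (x : X) : (1 / (k : ℝ)) * Real.log (B x) - φ x =
      (1 / (k : ℝ)) * (Real.log (B x) - k * φ x) := by
    field_simp
  simp_rw [hscale]
  rw [integral_const_mul]
  exact mul_nonpos_of_nonneg_of_nonpos (by positivity) hle
end

section
/- Let X be a measurable space, m a nonzero finite measure on X, N ≥ 1 and k ≥ 1 integers, and V an N-dimensional complex subspace of the bounded measurable functions X → ℂ such that (i) every f ∈ V with ∫_X |f|² dm = 0 equals the zero function, and (ii) for every x ∈ X there exists f ∈ V with f(x) ≠ 0. Given a bounded measurable φ : X → ℝ, let μ_φ := e^{φ}·m / (∫_X e^{φ} dm) (a probability measure), let (f_1, …, f_N) be an orthonormal basis of V for the inner product ⟨f, g⟩ := ∫_X f·conj(g)·e^{−kφ} dμ_φ, and define the normalized Bergman iteration step T(φ) := (1/k)·log((1/N)·Σ_{i=1}^N |f_i|²). Then ∫_X e^{T(φ)} dm ≤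 ∫_X e^{φ} dm. -/
open MeasureTheory

/-- Tangent-line form of Bernoulli's inequality for `s ↦ s ^ (1 / k)` at `s = e ^ (k t)`. -/
theorem exp_log_div_le_tangent {k : ℕ} (hk : 1 ≤ k) {s : ℝ} (hs : 0 < s) (t : ℝ) :
    Real.exp ((1 / (k : ℝ)) * Real.log s) ≤
      Real.exp t + (1 / (k : ℝ)) * (s * (Real.exp (-((k : ℝ) * t)) * Real.exp t) - Real.exp t) := by
  have hk0 : (0 : ℝ) < k := by exact_mod_cast hk
  set u := (1 / (k : ℝ)) * Real.log s - t with hu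
  have hroot : Real.exp ((1 / (k : ℝ)) * Real.log s) = Real.exp t * Real.exp u := by
    rw [← Real.exp_add, hu]; ring_nf
  have hpow : s * Real.exp (-((k : ℝ) * t)) = Real.exp u ^ k := by
    rw [← Real.exp_nat_mul]
    nth_rewrite 1 [← Real.exp_log hs]
    rw [← Real.exp_add, hu]
    congr 1
    field_simp
    ring
  have hbern : 1 + (k : ℝ) * (Real.exp u - 1) ≤ Real.exp u ^ k := by
    have := one_add_mul_le_pow (a := Real.exp u - 1) (by linarith [Real.exp_pos u]) k
    simpa using this
  have hle : Real.exp u ≤ 1 + (1 / (k : ℝ)) * (Real.exp u ^ k - 1) := by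
    rw [one_div, ← sub_le_iff_le_add', le_inv_mul_iff₀ hk0]
    linarith
  calc _ = Real.exp t * Real.exp u := hroot
    _ ≤ Real.exp t * (1 + (1 / (k : ℝ)) * (Real.exp u ^ k - 1)) := by gcongr
    _ = _ := by rw [← mul_assoc s, hpow]; ring

/-- If the functions `f i` span a space with no common zero, then `∑ ‖f i x‖ ^ 2 > 0`. -/
theorem sum_norm_sq_pos_of_mem_span {X ι : Type*} [Fintype ι] {f : ι → X → ℂ} {g : X → ℂ} {x : X}
    (hg : g ∈ Submodule.span ℂ (Set.range f)) (hgx : g x ≠ 0) : 0 < ∑ i, ‖f i x‖ ^ 2 := by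
  obtain ⟨i, hi⟩ : ∃ i, f i x ≠ 0 := by
    by_contra! h
    have hle : Submodule.span ℂ (Set.range f) ≤ LinearMap.ker (LinearMap.proj (R := ℂ) x) := by
      rw [Submodule.span_le]
      rintro _ ⟨i, rfl⟩
      simpa using h i
    exact hgx (by simpa using hle hg)
  exact Finset.sum_pos' (fun _ _ => by positivity) ⟨i, Finset.mem_univ i, by positivity⟩

/-- Abstract form of the monotonicity of `−I₊` along the normalized Bergman
iteration in the `+K_X`-setting: with `μ_φ = e^{φ}·m / ∫ e^{φ} dm` and
`(f_1, …, f_N)` an orthonormal basis of `V` for the inner product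
`⟨f,g⟩ = ∫ f·conj g·e^{-kφ} dμ_φ`, the normalized Bergman iteration step
`T(φ) = (1/k)·log((1/N)·Σ |f_i|²)` satisfies `∫ e^{T(φ)} dm ≤ ∫ e^{φ} dm`. -/
theorem normalized_bergman_step_plus_KX
    {X : Type*} [MeasurableSpace X] (m : Measure X) [IsFiniteMeasure m]
    (hm : m ≠ 0)
    (N k : ℕ) (hN : 1 ≤ N) (hk : 1 ≤ k)
    (V : Submodule ℂ (X → ℂ))
    (hVmeas : ∀ f ∈ V, Measurable f)
    (hVbdd : ∀ f ∈ V, ∃ C : ℝ, ∀ x, ‖f x‖ ≤ C)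
    (hVdim : Module.finrank ℂ V = N)
    (hVnondeg : ∀ f ∈ V, (∫ x, ‖f x‖ ^ 2 ∂m) = 0 → f = 0)
    (hVpt : ∀ x : X, ∃ f ∈ V, f x ≠ 0)
    (φ : X → ℝ) (hφm : Measurable φ) (hφb : ∃ C : ℝ, ∀ x, |φ x| ≤ C)
    (f : Fin N → X → ℂ) (hfV : ∀ i, f i ∈ V)
    (hspan : Submodule.span ℂ (Set.range f) = V)
    (hON : ∀ i j, (∫ x, f i x * (starRingEnd ℂ) (f j x) *
        ((Real.exp (-((k : ℝ) * φ x)) * Real.exp (φ x) /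
          (∫ y, Real.exp (φ y) ∂m) : ℝ) : ℂ) ∂m) = if i = j then 1 else 0) :
    (∫ x, Real.exp ((1 / (k : ℝ)) *
        Real.log ((1 / (N : ℝ)) * ∑ i, ‖f i x‖ ^ 2)) ∂m) ≤
      ∫ x, Real.exp (φ x) ∂m := by
  set Z := ∫ y, Real.exp (φ y) ∂m with hZ
  set w : X → ℝ := fun x => Real.exp (-((k : ℝ) * φ x)) * Real.exp (φ x) with hw
  have hnorm : ∀ i, ∫ x, ‖f i x‖ ^ 2 * (w x / Z) ∂m = 1 := by
    intro i
    have h := hON i i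
    rw [if_pos rfl] at h
    rw [← Complex.ofReal_inj, ← integral_complex_ofReal, Complex.ofReal_one, ← h]
    refine integral_congr_ae (.of_forall fun x => ?_)
    simp only [Complex.mul_conj']
    push_cast [hw]
    rfl
  have hZ0 : Z ≠ 0 := by
    intro h
    simpa [h] using hnorm ⟨0, hN⟩
  have hN0 : (0 : ℝ) < N := by exact_mod_cast hN
  have hexp : Integrable (fun x => Real.exp (φ x)) m := .of_integral_ne_zero hZ0
  have hint : ∀ i, Integrable (fun x => ‖f i x‖ ^ 2 * (w x / Z)) m := fun i =>
    .of_integral_ne_zero (by rw [hnorm i]; exact one_ne_zero)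
  have hρ : (fun x => ((1 / (N : ℝ)) * ∑ i, ‖f i x‖ ^ 2) * w x) =
      fun x => (Z / N) * ∑ i, ‖f i x‖ ^ 2 * (w x / Z) := by
    funext x
    rw [← Finset.sum_mul]
    field_simp
  have hρ_int : Integrable (fun x => ((1 / (N : ℝ)) * ∑ i, ‖f i x‖ ^ 2) * w x) m := by
    rw [hρ]
    exact (integrable_finsetSum _ fun i _ => hint i).const_mul _
  have hρ_eq : ∫ x, ((1 / (N : ℝ)) * ∑ i, ‖f i x‖ ^ 2) * w x ∂m = Z := by
    rw [hρ, integral_const_mul, integral_finsetSum _ fun i _ => hint i]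
    simp only [hnorm, Finset.sum_const, Finset.card_univ, Fintype.card_fin, nsmul_eq_mul, mul_one]
    field_simp
  have hcorr : Integrable (fun x => (1 / (k : ℝ)) *
      (((1 / (N : ℝ)) * ∑ i, ‖f i x‖ ^ 2) * w x - Real.exp (φ x))) m :=
    (hρ_int.sub hexp).const_mul _
  calc _ ≤ ∫ x, (Real.exp (φ x) + (1 / (k : ℝ)) *
          (((1 / (N : ℝ)) * ∑ i, ‖f i x‖ ^ 2) * w x - Real.exp (φ x))) ∂m := by
        refine integral_mono_of_nonneg (.of_forall fun x => (Real.exp_pos _).le)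
          (hexp.add hcorr) (.of_forall fun x => ?_)
        obtain ⟨g, hgV, hgx⟩ := hVpt x
        have hS := sum_norm_sq_pos_of_mem_span (hspan.symm ▸ hgV) hgx
        exact exp_log_div_le_tangent hk (by positivity) (φ x)
    _ = Z := by
        rw [integral_add hexp hcorr, integral_const_mul,
          integral_sub hρ_int hexp, hρ_eq, ← hZ]
        ring
end

section
/- Let E be a finite-dimensional real normed vector space and f : E → ℝ a continuous strictly convex function (i.e. f((1−t)·x + t·y) < (1−t)·f(x) + t·f(y) for all x ≠ y and t ∈ (0,1)) attaining a global minimum at some point x₀ ∈ E. Then there exist δ > 0 and C ∈ ℝ such that f(x) ≥ δ·‖x − x₀‖ − C for all x ∈ E. -/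
/-- Coercivity from strict convexity: a continuous strictly convex function on
a finite-dimensional normed space attaining a global minimum at `x₀` grows at
least linearly: `f(x) ≥ δ·‖x − x₀‖ − C` for some `δ > 0` and `C`. -/
theorem coercive_of_strictConvexOn_of_min
    {E : Type*} [NormedAddCommGroup E] [NormedSpace ℝ E] [FiniteDimensional ℝ E]
    (f : E → ℝ) (hcont : Continuous f)
    (hconv : StrictConvexOn ℝ Set.univ f)
    (x₀ : E) (hmin : ∀ x, f x₀ ≤ f x) :
    ∃ δ : ℝ, 0 < δ ∧ ∃ C : ℝ, ∀ x : E, δ * ‖x - x₀‖ - C ≤ f x := by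
  obtain ⟨δ, hδ, hsphere⟩ : ∃ δ : ℝ, 0 < δ ∧ ∀ z ∈ Metric.sphere x₀ 1, f x₀ + δ ≤ f z := by
    rcases (Metric.sphere x₀ (1 : ℝ)).eq_empty_or_nonempty with h | h
    · exact ⟨1, one_pos, by simp [h]⟩
    · have := FiniteDimensional.proper ℝ E
      obtain ⟨y, hy, hymin⟩ := (isCompact_sphere x₀ 1).exists_isMinOn h hcont.continuousOn
      have hne : y ≠ x₀ := Metric.ne_of_mem_sphere hy one_ne_zero
      have hlt : f x₀ < f y := by
        refine (hmin y).lt_of_ne fun heq => hne ?_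
        exact hconv.eq_of_isMinOn (fun x _ => heq ▸ hmin x) (fun x _ => hmin x)
          (Set.mem_univ _) (Set.mem_univ _)
      refine ⟨f y - f x₀, sub_pos.2 hlt, fun z hz => ?_⟩
      have : f y ≤ f z := hymin hz
      linarith
  refine ⟨δ, hδ, δ - f x₀, fun x => ?_⟩
  rcases le_or_gt ‖x - x₀‖ 1 with hr | hr
  · nlinarith [hmin x]
  · have hpos : 0 < ‖x - x₀‖ := one_pos.trans hr
    have hinv : ‖x - x₀‖⁻¹ ≤ 1 := inv_le_one_of_one_le₀ hr.le
    have hz := hsphere ((1 - ‖x - x₀‖⁻¹) • x₀ + ‖x - x₀‖⁻¹ • x) (by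
      have : (1 - ‖x - x₀‖⁻¹) • x₀ + ‖x - x₀‖⁻¹ • x - x₀ = ‖x - x₀‖⁻¹ • (x - x₀) := by
        module
      rw [mem_sphere_iff_norm, this, norm_smul, norm_inv, norm_norm, inv_mul_cancel₀ hpos.ne'])
    have hc := hconv.convexOn.2 (Set.mem_univ x₀) (Set.mem_univ x)
      (sub_nonneg.2 hinv) (inv_nonneg.2 hpos.le) (by ring)
    simp only [smul_eq_mul] at hc
    have hδle : δ ≤ ‖x - x₀‖⁻¹ * (f x - f x₀) := by linarith
    rw [← div_eq_inv_mul, le_div_iff₀ hpos] at hδle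
    linarith
end
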